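/- Let σ₁ > 1, σ₂ > 1, σ₃ > 0, and suppose ρ̃ := (σ₃² − 1)/√((σ₁² − 1)(σ₂² − 1)) satisfies |ρ̃| < 1. Set b = σ₃²/√((σ₁² − 1)(σ₂² − 1)). Then for every x ∈ ℝ, ∫_{ℝ} ∫_{ℝ} ∫_{ℝ} ( (√(σ₁²−1) z₁ − x)(√(σ₂²−1) z₂ − x) − σ₃² z₃² ) · 1_{√(σ₁²−1) z₁ < x} · 1_{√(σ₂²−1) z₂ < x} · 1_{(√(σ₁²−1) z₁ − x)(√(σ₂²−1) z₂ − x) − σ₃² z₃² > 0} · φ(z₃) · P_{ρ̃}(z₁,z₂) dz₁ dz₂ dz₃ = 2 ∫_{ℝ²} g(z₁, z₂, x | σ₁² − 1, σ₂² − 1, σ₃²) · P_{ρ̃}(z₁,z₂) dz₁ dz₂. (This evaluates the numerator J₂ = E[|det(∇²X)| 1_{∇²X ≺ 0} | X = x] in the peak height density of a planar stationary Gaussian field, after standardizing the conditional Gaussian law of the Hessian given X = x.) -/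

import Mathlib

open MeasureTheory Real

/-- The standard normal pdf. -/
noncomputable def stdPdf (x : ℝ) : ℝ := (Real.sqrt (2 * Real.pi))⁻¹ * Real.exp (-x ^ 2 / 2)

/-- The standard normal cdf. -/
noncomputable def stdCdf (x : ℝ) : ℝ := ∫ s in Set.Iio x, stdPdf s

/-- The joint density of a standard bivariate normal vector with correlation ρ. -/
noncomputable def binormPdf (ρ x y : ℝ) : ℝ :=
  (2 * Real.pi * Real.sqrt (1 - ρ ^ 2))⁻¹ *
    Real.exp (-(x ^ 2 - 2 * ρ * x * y + y ^ 2) / (2 * (1 - ρ ^ 2)))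

/-- The function `g(z₁, z₂, x | a₁², a₂², a₃²)`, where `a₁, a₂, a₃ > 0` are the (unsquared)
parameters and `b = a₃²/(a₁a₂)`. -/
noncomputable def gFun (z₁ z₂ x a₁ a₂ a₃ : ℝ) : ℝ :=
  a₁ * a₂ *
      (((z₁ - x / a₁) * (z₂ - x / a₂) - a₃ ^ 2 / (a₁ * a₂)) *
          (stdCdf (Real.sqrt ((z₁ - x / a₁) * (z₂ - x / a₂) / (a₃ ^ 2 / (a₁ * a₂)))) - 1 / 2) +
        Real.sqrt (a₃ ^ 2 / (a₁ * a₂) * ((z₁ - x / a₁) * (z₂ - x / a₂))) *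
          stdPdf (Real.sqrt ((z₁ - x / a₁) * (z₂ - x / a₂) / (a₃ ^ 2 / (a₁ * a₂))))) *
    (if z₁ < x / a₁ then (1 : ℝ) else 0) * (if z₂ < x / a₂ then (1 : ℝ) else 0)

open ProbabilityTheory

theorem stdPdf_eq_gaussianPDFReal : stdPdf = gaussianPDFReal 0 1 := by
  ext x
  simp [stdPdf, gaussianPDFReal]

theorem continuous_stdPdf : Continuous stdPdf := by
  unfold stdPdf
  fun_prop

theorem stdPdf_nonneg (x : ℝ) : 0 ≤ stdPdf x := by
  unfold stdPdf
  positivity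

theorem integrable_stdPdf : Integrable stdPdf := by
  rw [stdPdf_eq_gaussianPDFReal]
  exact integrable_gaussianPDFReal 0 1

theorem integral_stdPdf : ∫ x, stdPdf x = 1 := by
  rw [stdPdf_eq_gaussianPDFReal]
  exact integral_gaussianPDFReal_eq_one 0 one_ne_zero

theorem stdPdf_neg (x : ℝ) : stdPdf (-x) = stdPdf x := by
  simp [stdPdf]

theorem hasDerivAt_stdPdf (x : ℝ) : HasDerivAt stdPdf (-x * stdPdf x) x := by
  unfold stdPdf
  have h : HasDerivAt (fun y : ℝ => -y ^ 2 / 2) (-x) x := by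
    refine ((hasDerivAt_pow 2 x).neg.div_const 2).congr_deriv ?_
    norm_num
    ring
  refine (h.exp.const_mul (Real.sqrt (2 * Real.pi))⁻¹).congr_deriv ?_
  ring

theorem stdCdf_eq_Iic (x : ℝ) : stdCdf x = ∫ s in Set.Iic x, stdPdf s :=
  integral_Iic_eq_integral_Iio.symm

theorem stdCdf_add_stdCdf_neg (x : ℝ) : stdCdf x + stdCdf (-x) = 1 := by
  have h : ∫ s in Set.Iic (-x), stdPdf s = ∫ s in Set.Ioi x, stdPdf s := by
    simpa [stdPdf_neg] using integral_comp_neg_Iic (-x) stdPdf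
  rw [stdCdf_eq_Iic, stdCdf_eq_Iic, h, ← integral_stdPdf,
    intervalIntegral.integral_Iic_add_Ioi integrable_stdPdf.integrableOn
      integrable_stdPdf.integrableOn]

theorem intervalIntegral_stdPdf_symm (c : ℝ) :
    ∫ w in (-c)..c, stdPdf w = 2 * (stdCdf c - 1 / 2) := by
  rw [← intervalIntegral.integral_Iic_sub_Iic integrable_stdPdf.integrableOn
    integrable_stdPdf.integrableOn, ← stdCdf_eq_Iic, ← stdCdf_eq_Iic]
  linarith [stdCdf_add_stdCdf_neg c]

theorem intervalIntegral_quadratic_mul_stdPdf (u t c : ℝ) :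
    ∫ w in (-c)..c, (u - t * w ^ 2) * stdPdf w =
      2 * ((u - t) * (stdCdf c - 1 / 2) + t * c * stdPdf c) := by
  have hd : ∀ w ∈ Set.uIcc (-c) c,
      HasDerivAt (fun y => y * stdPdf y) (stdPdf w - w ^ 2 * stdPdf w) w := by
    intro w _
    refine ((hasDerivAt_id' w).mul (hasDerivAt_stdPdf w)).congr_deriv ?_
    ring
  have hc := continuous_stdPdf
  have hi : ∫ w in (-c)..c, (stdPdf w - w ^ 2 * stdPdf w) = 2 * (c * stdPdf c) := by
    rw [intervalIntegral.integral_eq_sub_of_hasDerivAt hd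
      (Continuous.intervalIntegrable (by fun_prop) _ _), stdPdf_neg]
    ring
  have hs : ∀ w, (u - t * w ^ 2) * stdPdf w =
      (u - t) * stdPdf w + t * (stdPdf w - w ^ 2 * stdPdf w) := fun w => by ring
  simp_rw [hs]
  rw [intervalIntegral.integral_add (Continuous.intervalIntegrable (by fun_prop) _ _)
    (Continuous.intervalIntegrable (by fun_prop) _ _), intervalIntegral.integral_const_mul,
    intervalIntegral.integral_const_mul, hi, intervalIntegral_stdPdf_symm]
  ring

theorem integral_quadratic_posPart_mul_stdPdf {u s : ℝ} (hu : 0 < u) (hs : 0 < s) :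
    ∫ w, (u - s ^ 2 * w ^ 2) * (if u - s ^ 2 * w ^ 2 > 0 then (1 : ℝ) else 0) * stdPdf w =
      2 * ((u - s ^ 2) * (stdCdf (√(u / s ^ 2)) - 1 / 2) +
        √(s ^ 2 * u) * stdPdf (√(u / s ^ 2))) := by
  set c := √(u / s ^ 2)
  have hc0 : 0 ≤ c := Real.sqrt_nonneg _
  have hcs : c ^ 2 = u / s ^ 2 := Real.sq_sqrt (by positivity)
  have hsc : √(s ^ 2 * u) = s ^ 2 * c := by
    have : s ^ 2 * u = (s ^ 2 * c) ^ 2 := by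
      rw [mul_pow, hcs]
      field_simp
    rw [this, Real.sqrt_sq (by positivity)]
  rw [hsc, ← intervalIntegral_quadratic_mul_stdPdf u (s ^ 2) c,
    intervalIntegral.integral_of_le (by linarith), integral_Ioc_eq_integral_Ioo,
    ← integral_indicator measurableSet_Ioo]
  congr 1
  ext w
  have hiff : u - s ^ 2 * w ^ 2 > 0 ↔ w ∈ Set.Ioo (-c) c := by
    rw [Set.mem_Ioo, ← abs_lt, ← sq_lt_sq₀ (abs_nonneg w) hc0, sq_abs, hcs,
      lt_div_iff₀ (by positivity), gt_iff_lt, sub_pos, mul_comm]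
  by_cases hw : w ∈ Set.Ioo (-c) c
  · rw [if_pos (hiff.2 hw), Set.indicator_of_mem hw, mul_one]
  · rw [if_neg (fun h => hw (hiff.1 h)), Set.indicator_of_notMem hw]
    simp

/-- The product of the positive part of the Hessian determinant with its negative-definiteness
indicators, before weighting by the Gaussian densities. -/
noncomputable def negDefDet (a₁ a₂ s x z₁ z₂ w : ℝ) : ℝ :=
  ((a₁ * z₁ - x) * (a₂ * z₂ - x) - s ^ 2 * w ^ 2) *
    (if a₁ * z₁ < x then (1 : ℝ) else 0) *
    (if a₂ * z₂ < x then (1 : ℝ) else 0) *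
    (if (a₁ * z₁ - x) * (a₂ * z₂ - x) - s ^ 2 * w ^ 2 > 0 then (1 : ℝ) else 0)

theorem integral_negDefDet_mul_stdPdf {a₁ a₂ s : ℝ} (ha₁ : 0 < a₁) (ha₂ : 0 < a₂) (hs : 0 < s)
    (x z₁ z₂ : ℝ) :
    ∫ w, negDefDet a₁ a₂ s x z₁ z₂ w * stdPdf w = 2 * gFun z₁ z₂ x a₁ a₂ s := by
  have h₁ : z₁ < x / a₁ ↔ a₁ * z₁ < x := by rw [lt_div_iff₀ ha₁, mul_comm]
  have h₂ : z₂ < x / a₂ ↔ a₂ * z₂ < x := by rw [lt_div_iff₀ ha₂, mul_comm]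
  unfold negDefDet gFun
  simp only [h₁, h₂]
  by_cases hz₁ : a₁ * z₁ < x
  swap
  · simp [hz₁]
  by_cases hz₂ : a₂ * z₂ < x
  swap
  · simp [hz₂]
  simp only [hz₁, hz₂, if_true, mul_one]
  have hu : 0 < (a₁ * z₁ - x) * (a₂ * z₂ - x) :=
    mul_pos_of_neg_of_neg (by linarith) (by linarith)
  rw [integral_quadratic_posPart_mul_stdPdf hu hs]
  set u := (a₁ * z₁ - x) * (a₂ * z₂ - x) with hu'
  have hv : (z₁ - x / a₁) * (z₂ - x / a₂) = u / (a₁ * a₂) := by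
    rw [hu']
    field_simp
  have hsqrt : √(s ^ 2 / (a₁ * a₂) * (u / (a₁ * a₂))) = √(s ^ 2 * u) / (a₁ * a₂) := by
    rw [show s ^ 2 / (a₁ * a₂) * (u / (a₁ * a₂)) = s ^ 2 * u / (a₁ * a₂) ^ 2 by ring,
      Real.sqrt_div' _ (by positivity), Real.sqrt_sq (by positivity)]
  have hdiv : u / (a₁ * a₂) / (s ^ 2 / (a₁ * a₂)) = u / s ^ 2 :=
    div_div_div_cancel_right₀ (by positivity) _ _
  rw [hv, hsqrt, hdiv]
  field_simp

theorem abs_negDefDet_le (a₁ a₂ s x z₁ z₂ w : ℝ) :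
    |negDefDet a₁ a₂ s x z₁ z₂ w| ≤ |a₁ * z₁ - x| * |a₂ * z₂ - x| := by
  have h0 : 0 ≤ |a₁ * z₁ - x| * |a₂ * z₂ - x| := by positivity
  unfold negDefDet
  by_cases h : (a₁ * z₁ - x) * (a₂ * z₂ - x) - s ^ 2 * w ^ 2 > 0
  · have h' : |(a₁ * z₁ - x) * (a₂ * z₂ - x) - s ^ 2 * w ^ 2| ≤
        |a₁ * z₁ - x| * |a₂ * z₂ - x| := by
      rw [abs_of_pos h, ← abs_mul]
      exact (sub_le_self _ (by positivity)).trans (le_abs_self _)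
    split_ifs <;> simp [h', h0]
  · simp [h, h0]

theorem measurable_negDefDet (a₁ a₂ s x : ℝ) :
    Measurable fun p : ℝ × ℝ × ℝ => negDefDet a₁ a₂ s x p.2.2 p.2.1 p.1 := by
  unfold negDefDet
  refine ((Measurable.mul (by fun_prop) ?_).mul ?_).mul ?_
  · exact Measurable.ite (measurableSet_lt (by fun_prop) (by fun_prop))
      measurable_const measurable_const
  · exact Measurable.ite (measurableSet_lt (by fun_prop) (by fun_prop))
      measurable_const measurable_const
  · exact Measurable.ite (measurableSet_lt (by fun_prop) (by fun_prop))
      measurable_const measurable_const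

theorem abs_binormPdf_le {ρ : ℝ} (hρ : |ρ| < 1) (x y : ℝ) :
    |binormPdf ρ x y| ≤ (2 * π * √(1 - ρ ^ 2))⁻¹ *
      (exp (-(2 * (1 + |ρ|))⁻¹ * x ^ 2) * exp (-(2 * (1 + |ρ|))⁻¹ * y ^ 2)) := by
  unfold binormPdf
  rw [abs_of_nonneg (by positivity), ← Real.exp_add]
  gcongr
  have h0 := abs_nonneg ρ
  have hxy : ρ * x * y * 2 ≤ |ρ| * (x ^ 2 + y ^ 2) := by
    have h1 : ρ * x * y ≤ |ρ| * |x * y| := by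
      rw [← abs_mul, ← mul_assoc]
      exact le_abs_self _
    have h2 : 2 * |x * y| ≤ x ^ 2 + y ^ 2 := by
      rw [abs_mul]
      nlinarith [sq_nonneg (|x| - |y|), sq_abs x, sq_abs y]
    nlinarith
  have hfac : 1 - ρ ^ 2 = (1 - |ρ|) * (1 + |ρ|) := by
    rw [← sq_abs ρ]
    ring
  have h1 : 0 < 1 - |ρ| := by linarith
  rw [hfac, div_le_iff₀ (by positivity)]
  have : (-(2 * (1 + |ρ|))⁻¹ * x ^ 2 + -(2 * (1 + |ρ|))⁻¹ * y ^ 2) *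
      (2 * ((1 - |ρ|) * (1 + |ρ|))) = -((1 - |ρ|) * (x ^ 2 + y ^ 2)) := by
    field_simp
    ring
  rw [this]
  linarith

theorem integrable_abs_affine_mul_exp_neg_mul_sq {c : ℝ} (hc : 0 < c) (a x : ℝ) :
    Integrable fun z : ℝ => |a * z - x| * exp (-c * z ^ 2) := by
  have h : Integrable fun z : ℝ => a * (z * exp (-c * z ^ 2)) - x * exp (-c * z ^ 2) :=
    ((integrable_mul_exp_neg_mul_sq hc).const_mul a).sub
      ((integrable_exp_neg_mul_sq hc).const_mul x)
  refine h.abs.congr (.of_forall fun z => ?_)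
  change |a * (z * exp (-c * z ^ 2)) - x * exp (-c * z ^ 2)| = _
  rw [← mul_assoc, ← sub_mul, abs_mul, abs_of_pos (exp_pos _)]

theorem integrable_gaussian_mul_abs_affine {c : ℝ} (hc : 0 < c) (C a₁ a₂ x : ℝ) :
    Integrable fun p : ℝ × ℝ × ℝ => stdPdf p.1 * (C *
      ((|a₂ * p.2.1 - x| * exp (-c * p.2.1 ^ 2)) * (|a₁ * p.2.2 - x| * exp (-c * p.2.2 ^ 2)))) :=
  integrable_stdPdf.mul_prod
    (((integrable_abs_affine_mul_exp_neg_mul_sq hc a₂ x).mul_prod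
      (integrable_abs_affine_mul_exp_neg_mul_sq hc a₁ x)).const_mul C)

theorem measurable_negDefDet_mul_stdPdf_mul_binormPdf (ρ a₁ a₂ s x : ℝ) :
    Measurable fun p : ℝ × ℝ × ℝ =>
      negDefDet a₁ a₂ s x p.2.2 p.2.1 p.1 * stdPdf p.1 * binormPdf ρ p.2.2 p.2.1 := by
  have hP : Measurable fun p : ℝ × ℝ × ℝ => binormPdf ρ p.2.2 p.2.1 := by
    unfold binormPdf
    fun_prop
  exact ((measurable_negDefDet a₁ a₂ s x).mul
    (continuous_stdPdf.measurable.comp measurable_fst)).mul hP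

theorem integrable_negDefDet_mul_stdPdf_mul_binormPdf {ρ : ℝ} (hρ : |ρ| < 1) (a₁ a₂ s x : ℝ) :
    Integrable fun p : ℝ × ℝ × ℝ =>
      negDefDet a₁ a₂ s x p.2.2 p.2.1 p.1 * stdPdf p.1 * binormPdf ρ p.2.2 p.2.1 := by
  have hc : 0 < (2 * (1 + |ρ|))⁻¹ := by positivity
  refine (integrable_gaussian_mul_abs_affine hc (2 * π * √(1 - ρ ^ 2))⁻¹ a₁ a₂ x).mono'
    (measurable_negDefDet_mul_stdPdf_mul_binormPdf ρ a₁ a₂ s x).aestronglyMeasurable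
    (.of_forall fun p => ?_)
  have hφ0 := stdPdf_nonneg p.1
  rw [Real.norm_eq_abs, abs_mul, abs_mul, abs_of_nonneg hφ0]
  refine (mul_le_mul (mul_le_mul_of_nonneg_right (abs_negDefDet_le ..) hφ0)
    (abs_binormPdf_le hρ ..) (abs_nonneg _) (by positivity)).trans_eq ?_
  ring

theorem integral_negDefDet_mul_stdPdf_mul_binormPdf {a₁ a₂ s ρ : ℝ} (ha₁ : 0 < a₁) (ha₂ : 0 < a₂)
    (hs : 0 < s) (hρ : |ρ| < 1) (x : ℝ) :
    ∫ w, ∫ z₂, ∫ z₁, negDefDet a₁ a₂ s x z₁ z₂ w * stdPdf w * binormPdf ρ z₁ z₂ =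
      2 * ∫ z : ℝ × ℝ, gFun z.1 z.2 x a₁ a₂ s * binormPdf ρ z.1 z.2 := by
  have hF := integrable_negDefDet_mul_stdPdf_mul_binormPdf hρ a₁ a₂ s x
  calc
    _ = ∫ w, ∫ p : ℝ × ℝ,
        negDefDet a₁ a₂ s x p.2 p.1 w * stdPdf w * binormPdf ρ p.2 p.1 := by
      refine integral_congr_ae ?_
      filter_upwards [hF.prod_right_ae] with w hw
      exact (integral_prod _ hw).symm
    _ = ∫ p : ℝ × ℝ, ∫ w,
        negDefDet a₁ a₂ s x p.2 p.1 w * stdPdf w * binormPdf ρ p.2 p.1 :=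
      integral_integral_swap hF
    _ = ∫ p : ℝ × ℝ, 2 * (gFun p.2 p.1 x a₁ a₂ s * binormPdf ρ p.2 p.1) := by
      simp_rw [integral_mul_const, integral_negDefDet_mul_stdPdf ha₁ ha₂ hs, mul_assoc]
    _ = _ := by
      rw [integral_const_mul]
      congr 1
      exact integral_prod_swap
        (fun z : ℝ × ℝ => gFun z.1 z.2 x a₁ a₂ s * binormPdf ρ z.1 z.2)

theorem stmt_6 (σ₁ σ₂ σ₃ : ℝ) (h₁ : 1 < σ₁) (h₂ : 1 < σ₂) (h₃ : 0 < σ₃)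
    (hρ : |(σ₃ ^ 2 - 1) / Real.sqrt ((σ₁ ^ 2 - 1) * (σ₂ ^ 2 - 1))| < 1) (x : ℝ) :
    (∫ z₃ : ℝ, ∫ z₂ : ℝ, ∫ z₁ : ℝ,
        ((Real.sqrt (σ₁ ^ 2 - 1) * z₁ - x) * (Real.sqrt (σ₂ ^ 2 - 1) * z₂ - x) -
            σ₃ ^ 2 * z₃ ^ 2) *
          (if Real.sqrt (σ₁ ^ 2 - 1) * z₁ < x then (1 : ℝ) else 0) *
          (if Real.sqrt (σ₂ ^ 2 - 1) * z₂ < x then (1 : ℝ) else 0) *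
          (if (Real.sqrt (σ₁ ^ 2 - 1) * z₁ - x) * (Real.sqrt (σ₂ ^ 2 - 1) * z₂ - x) -
              σ₃ ^ 2 * z₃ ^ 2 > 0 then (1 : ℝ) else 0) *
          stdPdf z₃ *
          binormPdf ((σ₃ ^ 2 - 1) / Real.sqrt ((σ₁ ^ 2 - 1) * (σ₂ ^ 2 - 1))) z₁ z₂) =
      2 * ∫ z : ℝ × ℝ,
        gFun z.1 z.2 x (Real.sqrt (σ₁ ^ 2 - 1)) (Real.sqrt (σ₂ ^ 2 - 1)) σ₃ *
          binormPdf ((σ₃ ^ 2 - 1) / Real.sqrt ((σ₁ ^ 2 - 1) * (σ₂ ^ 2 - 1))) z.1 z.2 := by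
  exact integral_negDefDet_mul_stdPdf_mul_binormPdf
    (Real.sqrt_pos.2 (by nlinarith)) (Real.sqrt_pos.2 (by nlinarith)) h₃ hρ x
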